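/- Let N ≥ 2. The penalty functional R : (ℝ^d)^N → [0,+∞] is lower semicontinuous: for every configuration (x₀,…,x_{N−1}) and every sequence (x₀ⁿ,…,x_{N−1}ⁿ) converging to it componentwise in ℝ^d, one has R(x₀,…,x_{N−1}) ≤ liminf_{n→∞} R(x₀ⁿ,…,x_{N−1}ⁿ). -/

import Mathlib

open MeasureTheory Filter Topology
open scoped ENNReal Classical

/-- The penalty functional for a star-shaped graph with center `x 0` and outer vertices
`x 1, …, x (N-1)`:
`R(x₀,…,x_{N−1}) = Σ_{i=1}^{N−1} ( 1/‖x_i − x₀‖ + (1/2) Σ_{j≠i, j≥1} 1/α_{ij} )`,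
where `α_{ij} ∈ [0,π]` is the unsigned angle between `x_i − x₀` and `x_j − x₀` and all
reciprocals are computed in `[0,+∞]` with the convention `1/0 = +∞`. -/
noncomputable def starPenalty {d : ℕ} (N : ℕ) (x : ℕ → EuclideanSpace ℝ (Fin d)) :
    ℝ≥0∞ :=
  ∑ i ∈ Finset.Ico 1 N,
    ((ENNReal.ofReal ‖x i - x 0‖)⁻¹ +
      2⁻¹ * ∑ j ∈ (Finset.Ico 1 N).erase i,
        (ENNReal.ofReal (InnerProductGeometry.angle (x i - x 0) (x j - x 0)))⁻¹)

/-- The reciprocal of an edge length bounds the penalty from below. -/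
theorem inv_norm_le_starPenalty {d N : ℕ} (x : ℕ → EuclideanSpace ℝ (Fin d)) {i : ℕ}
    (hi : i ∈ Finset.Ico 1 N) :
    (ENNReal.ofReal ‖x i - x 0‖)⁻¹ ≤ starPenalty N x :=
  le_self_add.trans <| Finset.single_le_sum
    (f := fun i => (ENNReal.ofReal ‖x i - x 0‖)⁻¹ +
      2⁻¹ * ∑ j ∈ (Finset.Ico 1 N).erase i,
        (ENNReal.ofReal (InnerProductGeometry.angle (x i - x 0) (x j - x 0)))⁻¹)
    (fun _ _ => zero_le) hi

/-- The penalty is continuous along componentwise convergence: it blows up when an edge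
degenerates, and otherwise all its terms converge. -/
theorem tendsto_starPenalty {ι : Type*} {l : Filter ι} {d N : ℕ}
    {x : ℕ → EuclideanSpace ℝ (Fin d)} {y : ι → ℕ → EuclideanSpace ℝ (Fin d)}
    (h : ∀ i < N, Tendsto (fun n => y n i) l (𝓝 (x i))) :
    Tendsto (fun n => starPenalty N (y n)) l (𝓝 (starPenalty N x)) := by
  have hsub : ∀ i ∈ Finset.Ico 1 N, Tendsto (fun n => y n i - y n 0) l (𝓝 (x i - x 0)) := by
    intro i hi
    rw [Finset.mem_Ico] at hi
    exact (h i hi.2).sub (h 0 (by lia))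
  have hinv : ∀ i ∈ Finset.Ico 1 N, Tendsto (fun n => (ENNReal.ofReal ‖y n i - y n 0‖)⁻¹) l
      (𝓝 (ENNReal.ofReal ‖x i - x 0‖)⁻¹) := fun i hi =>
    (ENNReal.tendsto_ofReal (hsub i hi).norm).inv
  by_cases hdeg : ∃ i ∈ Finset.Ico 1 N, x i - x 0 = 0
  · obtain ⟨i, hi, hi0⟩ := hdeg
    have htop : (ENNReal.ofReal ‖x i - x 0‖)⁻¹ = ⊤ := by simp [hi0]
    have hR : starPenalty N x = ⊤ :=
      top_le_iff.1 (htop ▸ inv_norm_le_starPenalty x hi)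
    rw [hR]
    exact tendsto_of_tendsto_of_tendsto_of_le_of_le (htop ▸ hinv i hi) tendsto_const_nhds
      (fun n => inv_norm_le_starPenalty (y n) hi) (fun _ => le_top)
  · push Not at hdeg
    refine tendsto_finsetSum _ fun i hi => (hinv i hi).add ?_
    refine ENNReal.Tendsto.const_mul (tendsto_finsetSum _ fun j hj => ?_) (Or.inr (by simp))
    have hj' := Finset.mem_of_mem_erase hj
    have hangle := (InnerProductGeometry.continuousAt_angle (x := (x i - x 0, x j - x 0))
      (hdeg i hi) (hdeg j hj')).tendsto.comp ((hsub i hi).prodMk_nhds (hsub j hj'))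
    exact (ENNReal.tendsto_ofReal hangle).inv

/-- the penalty functional `R` is lower semicontinuous: for every
configuration and every sequence of configurations converging to it componentwise,
`R(x) ≤ liminf_n R(xⁿ)`. -/
theorem starPenalty_lower_semicontinuous {d : ℕ} (N : ℕ) (hN : 2 ≤ N)
    (x : ℕ → EuclideanSpace ℝ (Fin d)) (xn : ℕ → ℕ → EuclideanSpace ℝ (Fin d))
    (hconv : ∀ i < N, Tendsto (fun n => xn n i) atTop (𝓝 (x i))) :
    starPenalty N x ≤ atTop.liminf (fun n => starPenalty N (xn n)) :=
  (tendsto_starPenalty hconv).liminf_eq.ge
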